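/- arXiv:2205.08564 — 2 statements merged into one kernel-verified Lean document; each statement's English description precedes it below -/
import Mathlib

section
/- Let G be a simple graph of order 2n with minimum degree at least 1. If all vertices of G, except possibly one, have degree at least n+1 in G, then G has a perfect matching. -/
namespace SimpleGraph

variable {V : Type*} {G : SimpleGraph V}

/-- A partial matching of `G`, encoded as an involution whose fixed points are the unmatched
vertices. -/
def IsMatchingInvolution (G : SimpleGraph V) (f : V → V) : Prop :=
  Function.Involutive f ∧ ∀ v, f v ≠ v → G.Adj v (f v)

namespace IsMatchingInvolution

lemma swap [DecidableEq V] {u w : V} (h : G.Adj u w) :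
    G.IsMatchingInvolution (Equiv.swap u w) := by
  refine ⟨Equiv.swap_apply_self u w, fun v hv => ?_⟩
  have := h.symm
  grind

lemma exists_isPerfectMatching {f : V → V} (hf : G.IsMatchingInvolution f)
    (hfix : ∀ v, f v ≠ v) : ∃ M : G.Subgraph, M.IsPerfectMatching := by
  refine ⟨{ verts := Set.univ, Adj := fun v w => f v = w, adj_sub := ?_, edge_vert := by simp,
            symm := ⟨?_⟩ }, ?_⟩
  · rintro v _ rfl
    exact hf.2 v (hfix v)
  · rintro v _ rfl
    exact hf.1 v
  · rw [Subgraph.isPerfectMatching_iff]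
    exact fun v => ⟨f v, rfl, fun w hw => Eq.symm (a := f v) hw⟩

/-- Matching two adjacent unmatched vertices `x`, `y` with each other. -/
lemma exists_extend_of_adj {f : V → V} (hf : G.IsMatchingInvolution f) {x y : V}
    (hx : f x = x) (hy : f y = y) (hxy : G.Adj x y) :
    ∃ g, G.IsMatchingInvolution g ∧ (∀ v, f v ≠ v → g v = f v) ∧ g x ≠ x := by
  classical
  obtain ⟨hinv, hadj⟩ := hf
  have hne := hxy.ne
  have hyx := hxy.symm
  refine ⟨fun v => if v = x then y else if v = y then x else f v, ⟨fun v => ?_, fun v hv => ?_⟩,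
    ?_, ?_⟩
  · have := hinv v
    grind
  · grind
  · grind
  · grind

/-- Augmenting along a path `x, a, f a, y` between unmatched vertices `x`, `y`. -/
lemma exists_augment {f : V → V} (hf : G.IsMatchingInvolution f) {x y a : V}
    (hx : f x = x) (hy : f y = y) (hxy : x ≠ y) (ha : f a ≠ a) (hxa : G.Adj x a)
    (hya : G.Adj y (f a)) :
    ∃ g, G.IsMatchingInvolution g ∧ (∀ v, f v ≠ v → v ≠ a → v ≠ f a → g v = f v) ∧
      (∀ v, f v ≠ v → g v ≠ v) ∧ g x ≠ x := by
  classical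
  obtain ⟨hinv, hadj⟩ := hf
  have hax := hxa.symm
  have hay := hya.symm
  have hinva := hinv a
  have h1 := hxa.ne
  have h2 := hya.ne
  refine ⟨fun v => if v = x then a else if v = a then x else if v = y then f a else
    if v = f a then y else f v, ⟨fun v => ?_, fun v hv => ?_⟩, ?_, fun v hv => ?_, ?_⟩
  · have := hinv v
    grind
  all_goals grind

/-- A partial matching of a graph with an even number of vertices that leaves a vertex unmatched
leaves another vertex unmatched. -/
lemma exists_other_fixed [Fintype V] {f : V → V} (hf : G.IsMatchingInvolution f)
    (heven : Even (Fintype.card V)) {x : V} (hx : f x = x) : ∃ y, y ≠ x ∧ f y = y := by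
  classical
  by_contra! h
  have hmod := Equiv.Perm.card_fixedPoints_modEq (p := 2) (n := 1) (f := f)
    ((pow_two (M := Function.End V) f).trans (funext hf.1))
  have h1 : Fintype.card (Function.fixedPoints f) = 1 := by
    rw [Fintype.card_eq_one_iff]
    exact ⟨⟨x, hx⟩, fun ⟨y, hy⟩ => Subtype.ext (by_contra fun hne => h y hne hy)⟩
  rw [h1] at hmod
  obtain ⟨k, hk⟩ := heven
  rw [hk, Nat.ModEq] at hmod
  omega

/-- A partial matching in which `u₀` is matched with `w` and some vertex is unmatched can be
enlarged, keeping the edge `u₀w`, if all vertices but `u₀` have large degree. -/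
lemma exists_larger [Fintype V] [DecidableEq V] [DecidableRel G.Adj] {n : ℕ}
    (hcard : Fintype.card V = 2 * n) {u₀ w : V} (hne : u₀ ≠ w)
    (hdeg : ∀ v, v ≠ u₀ → n + 1 ≤ G.degree v) {f : V → V} (hf : G.IsMatchingInvolution f)
    (hu : f u₀ = w) {x : V} (hx : f x = x) :
    ∃ g, G.IsMatchingInvolution g ∧ g u₀ = w ∧ (∀ v, f v ≠ v → g v ≠ v) ∧ g x ≠ x := by
  have hinv := hf.1
  obtain ⟨y, hyx, hy⟩ := hf.exists_other_fixed (by simp [hcard]) hx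
  have hw : f w = u₀ := by rw [← hu, hinv]
  by_cases h : ∃ z, f z = z ∧ G.Adj x z
  · obtain ⟨z, hz, hxz⟩ := h
    obtain ⟨g, hg, hgf, hgx⟩ := hf.exists_extend_of_adj hx hz hxz
    exact ⟨g, hg, by grind, by grind, hgx⟩
  push Not at h
  have hxu : x ≠ u₀ := by grind
  have hyu : y ≠ u₀ := by grind
  let A := (G.neighborFinset x \ {u₀, w}).image f
  let C := G.neighborFinset y \ {u₀, w}
  have hsub : A ∪ C ⊆ ({u₀, w, x, y} : Finset V)ᶜ := by
    intro b hb
    have hyx' : ¬ G.Adj y x := fun e => h y hy e.symm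
    have hyy : ¬ G.Adj y y := G.irrefl
    simp only [A, C, Finset.mem_union, Finset.mem_image, Finset.mem_sdiff,
      mem_neighborFinset, Finset.mem_insert, Finset.mem_singleton, Finset.mem_compl] at hb ⊢
    rcases hb with ⟨a, ha, rfl⟩ | hb
    · have := hinv a
      grind
    · grind
  have hpair : ({u₀, w} : Finset V).card = 2 := Finset.card_pair hne
  have hA : n + 1 ≤ A.card + 2 := by
    rw [Finset.card_image_of_injective _ hinv.injective]
    have := Finset.le_card_sdiff {u₀, w} (G.neighborFinset x)
    have := hdeg x hxu
    rw [← card_neighborFinset_eq_degree] at this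
    omega
  have hC : n + 1 ≤ C.card + 2 := by
    simp only [C]
    have := Finset.le_card_sdiff {u₀, w} (G.neighborFinset y)
    have := hdeg y hyu
    rw [← card_neighborFinset_eq_degree] at this
    omega
  have hfour : ({u₀, w, x, y} : Finset V).card = 4 := by
    rw [Finset.card_eq_succ]
    refine ⟨u₀, {w, x, y}, by grind, rfl, Finset.card_eq_three.2 ⟨w, x, y, ?_⟩⟩
    grind
  obtain ⟨b, hbA, hbC⟩ : ∃ b ∈ A, b ∈ C := by
    by_contra! hdisj
    have hd : Disjoint A C := Finset.disjoint_left.2 hdisj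
    have := Finset.card_le_card hsub
    rw [Finset.card_union_of_disjoint hd, Finset.card_compl, hfour] at this
    have := hfour ▸ Finset.card_le_univ ({u₀, w, x, y} : Finset V)
    omega
  simp only [A, C, Finset.mem_image, Finset.mem_sdiff,
    mem_neighborFinset, Finset.mem_insert, Finset.mem_singleton, not_or] at hbA hbC
  obtain ⟨a, ⟨hxa, hau, haw⟩, rfl⟩ := hbA
  have ha : f a ≠ a := fun e => h a e hxa
  obtain ⟨g, hg, hgf, hgne, hgx⟩ := hf.exists_augment hx hy hyx.symm ha hxa hbC.1
  exact ⟨g, hg, by grind, hgne, hgx⟩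

end IsMatchingInvolution

end SimpleGraph

/-- A simple graph of order `2n` with minimum degree at least `1`, in which all vertices
except possibly one have degree at least `n + 1`, has a perfect matching. -/
theorem perfect_matching_of_large_degrees :
    ∀ (V : Type) [Fintype V] [DecidableEq V] (G : SimpleGraph V) [DecidableRel G.Adj]
      (n : ℕ),
      Fintype.card V = 2 * n →
      (∀ v : V, 1 ≤ G.degree v) →
      (∃ u₀ : V, ∀ v : V, v ≠ u₀ → n + 1 ≤ G.degree v) →
      ∃ M : G.Subgraph, M.IsPerfectMatching := by
  intro V _ _ G _ n hcard hmin ⟨u₀, hdeg⟩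
  obtain ⟨w, hw⟩ := (G.degree_pos_iff_exists_adj u₀).1 (hmin u₀)
  obtain ⟨f, ⟨hf, hfu⟩, hmax⟩ := Set.exists_max_image
    {f : V → V | G.IsMatchingInvolution f ∧ f u₀ = w}
    (fun f => (Finset.univ.filter fun v => f v ≠ v).card) (Set.toFinite _)
    ⟨Equiv.swap u₀ w, .swap hw, Equiv.swap_apply_left u₀ w⟩
  refine hf.exists_isPerfectMatching fun x hx => ?_
  obtain ⟨g, hg, hgu, hgf, hgx⟩ := hf.exists_larger hcard hw.ne hdeg hfu hx
  refine (hmax g ⟨hg, hgu⟩).not_gt (Finset.card_lt_card ?_)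
  rw [Finset.ssubset_iff_of_subset fun v hv => by simpa using hgf v (by simpa using hv)]
  exact ⟨x, by simpa using hgx, by simpa using hx⟩
end

section
/- There exists a positive integer n₀ such that for all n ≥ n₀ the following holds: let G be a simple graph on 2n vertices and let N = {x₁,y₁,…,x_t,y_t} ⊆ V(G) be a set of 2t distinct vertices, where 1 ≤ t ≤ n is an integer. Then V(G) can be partitioned into two parts A and B such that: (i) |A| = |B|; (ii) |A ∩ {x_i, y_i}| = 1 for each i ∈ {1,…,t}; and (iii) |d_A(v) − d_B(v)| ≤ n^{2/3} − 1 for each vertex v ∈ V(G). -/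
open Finset in
/-- Derandomised Chernoff bound: finitely many linear forms with coefficients in `[-1, 1]` admit a
common choice of signs for which all of them are small. -/
theorem exists_signs_exp_mul_abs_sum_le {ι W : Type*} [Fintype ι] [Fintype W]
    (c : W → ι → ℝ) (hc : ∀ w i, |c w i| ≤ 1) (l : ℝ) :
    ∃ s : ι → Bool, ∀ w, Real.exp (l * |∑ i, c w i * (if s i then 1 else -1)|) ≤
      2 * Fintype.card W * Real.exp (Fintype.card ι * (l ^ 2 / 2)) := by
  classical
  let X : W → (ι → Bool) → ℝ := fun w s ↦ ∑ i, c w i * (if s i then 1 else -1)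
  have moment : ∀ w (m : ℝ), m ^ 2 = l ^ 2 → ∑ s, Real.exp (m * X w s) ≤
      2 ^ Fintype.card ι * Real.exp (Fintype.card ι * (l ^ 2 / 2)) := by
    intro w m hm
    have h1 : ∑ s, Real.exp (m * X w s) =
        ∏ i, ∑ b : Bool, Real.exp (m * (c w i * (if b then 1 else -1))) := by
      rw [prod_univ_sum, Fintype.piFinset_univ]
      refine sum_congr rfl fun s _ ↦ ?_
      rw [← Real.exp_sum, mul_sum]
    have h2 : ∀ i, ∑ b : Bool, Real.exp (m * (c w i * (if b then 1 else -1))) ≤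
        2 * Real.exp (l ^ 2 / 2) := by
      intro i
      have h3 := Real.cosh_le_exp_half_sq (m * c w i)
      have h4 : (m * c w i) ^ 2 ≤ l ^ 2 := by
        rw [mul_pow, hm]
        exact mul_le_of_le_one_right (sq_nonneg l) ((sq_le_one_iff_abs_le_one _).2 (hc w i))
      have h5 : Real.exp ((m * c w i) ^ 2 / 2) ≤ Real.exp (l ^ 2 / 2) := by gcongr
      rw [Real.cosh_eq] at h3
      simp only [Fintype.sum_bool, if_true, Bool.false_eq_true, if_false, mul_one, mul_neg]
      linarith
    calc _ = _ := h1
      _ ≤ ∏ _i : ι, 2 * Real.exp (l ^ 2 / 2) :=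
        prod_le_prod (fun i _ ↦ sum_nonneg fun b _ ↦ (Real.exp_pos _).le) fun i _ ↦ h2 i
      _ = _ := by rw [prod_const, card_univ, mul_pow, Real.exp_nat_mul]
  have total : ∑ s, ∑ w, (Real.exp (l * X w s) + Real.exp (-l * X w s)) ≤
      ∑ _s : ι → Bool, 2 * Fintype.card W * Real.exp (Fintype.card ι * (l ^ 2 / 2)) := by
    rw [sum_comm]
    calc _ ≤ ∑ _w : W, 2 * (2 ^ Fintype.card ι * Real.exp (Fintype.card ι * (l ^ 2 / 2))) := by
          refine sum_le_sum fun w _ ↦ ?_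
          rw [sum_add_distrib]
          linarith [moment w l rfl, moment w (-l) (neg_sq l)]
      _ = _ := by
          simp only [sum_const, card_univ, nsmul_eq_mul, Fintype.card_fun, Fintype.card_bool]
          push_cast
          ring
  obtain ⟨s, -, hs⟩ := exists_le_of_sum_le univ_nonempty total
  refine ⟨s, fun w ↦ le_trans ?_ hs⟩
  refine le_trans ?_ (single_le_sum (fun w _ ↦ by positivity) (mem_univ w))
  change Real.exp (l * |X w s|) ≤ _
  rcases abs_choice (X w s) with h | h <;> rw [h]
  · linarith [Real.exp_pos (-l * X w s)]
  · rw [mul_neg, ← neg_mul]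
    linarith [Real.exp_pos (l * X w s)]

open Filter Asymptotics in
theorem eventually_sqrt_mul_log_add_le :
    ∀ᶠ n : ℕ in atTop, √(n : ℝ) * (Real.log (4 * n) + 1 / 2) ≤ (n : ℝ) ^ ((2 : ℝ) / 3) - 1 := by
  have key : ∀ᶠ x : ℝ in atTop, √x * (Real.log (4 * x) + 1 / 2) ≤ x ^ ((2 : ℝ) / 3) - 1 := by
    have h1 := (isLittleO_log_rpow_atTop (r := 1 / 6) (by norm_num)).bound
      (show (0 : ℝ) < 1 / 4 by norm_num)
    have h2 := (tendsto_rpow_atTop (y := 1 / 6) (by norm_num)).eventually_ge_atTop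
      (4 * (Real.log 4 + 3))
    filter_upwards [h1, h2, eventually_ge_atTop 1] with x hx1 hx2 hx
    have hx0 : 0 < x := by linarith
    rw [Real.norm_of_nonneg (Real.log_nonneg hx), Real.norm_of_nonneg (by positivity)] at hx1
    have hs : 1 ≤ √x := Real.one_le_sqrt.2 hx
    have hp : x ^ ((2 : ℝ) / 3) = √x * x ^ ((1 : ℝ) / 6) := by
      rw [Real.sqrt_eq_rpow, ← Real.rpow_add hx0]
      norm_num
    rw [hp, Real.log_mul (by norm_num) hx0.ne']
    have h4 : 0 ≤ Real.log 4 := Real.log_nonneg (by norm_num)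
    nlinarith
  exact tendsto_natCast_atTop_atTop.eventually key

/-- A family of disjoint pairs in a set of size `2 * n` extends to a perfect pairing. -/
theorem exists_equiv_prod_bool_extending {V : Type*} [Fintype V] [DecidableEq V] {n t : ℕ}
    (hV : Fintype.card V = 2 * n) (ht : 1 ≤ t) (htn : t ≤ n) (a b : Fin t → V)
    (ha : ∀ i j, i ≠ j → a i ≠ a j) (hb : ∀ i j, i ≠ j → b i ≠ b j) (hab : ∀ i j, a i ≠ b j) :
    ∃ e : Fin n × Bool ≃ V, ∀ i : Fin t,
      e (Fin.castLE htn i, false) = a i ∧ e (Fin.castLE htn i, true) = b i := by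
  let f : Fin n × Bool → V := fun p ↦
    if h : p.1.1 < t then (if p.2 then b ⟨p.1, h⟩ else a ⟨p.1, h⟩) else a ⟨0, ht⟩
  have hinj : Set.InjOn f (Finset.univ.filter fun p : Fin n × Bool ↦ p.1.1 < t) := by
    rintro ⟨⟨i, hi⟩, x⟩ hx ⟨⟨j, hj⟩, y⟩ hy hxy
    simp only [Finset.coe_filter, Finset.mem_univ, true_and, Set.mem_ofPred_eq] at hx hy
    have ha' := ha ⟨i, hx⟩ ⟨j, hy⟩
    have hb' := hb ⟨i, hx⟩ ⟨j, hy⟩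
    have h1 := hab ⟨i, hx⟩ ⟨j, hy⟩
    have h2 := hab ⟨j, hy⟩ ⟨i, hx⟩
    cases x <;> cases y <;> simp [f, hx, hy] at hxy <;> grind
  obtain ⟨g, hg⟩ := Finset.exists_equiv_extend_of_card_eq (t := (Finset.univ : Finset V))
    (by simp [hV, mul_comm]) (Finset.subset_univ _) hinj
  refine ⟨g.trans (Equiv.subtypeUnivEquiv Finset.mem_univ), fun i ↦ ⟨?_, ?_⟩⟩
  · simpa [f] using hg (Fin.castLE htn i, false) (by simp)
  · simpa [f] using hg (Fin.castLE htn i, true) (by simp)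

/-- The set containing, from each pair of a pairing, the element selected by `s`. -/
def pairTransversal {V ι : Type*} [Fintype ι] (e : ι × Bool ≃ V) (s : ι → Bool) : Finset V :=
  Finset.univ.map ⟨fun i ↦ e (i, s i), fun _ _ h ↦ congrArg Prod.fst (e.injective h)⟩

theorem apply_mem_pairTransversal {V ι : Type*} [Fintype ι] (e : ι × Bool ≃ V) (s : ι → Bool)
    (i : ι) (x : Bool) : e (i, x) ∈ pairTransversal e s ↔ s i = x := by
  constructor
  · intro h
    obtain ⟨j, -, hj⟩ := Finset.mem_map.1 h
    obtain ⟨rfl, hx⟩ := Prod.mk.inj (e.injective hj)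
    exact hx
  · rintro rfl
    exact Finset.mem_map.2 ⟨i, Finset.mem_univ i, rfl⟩

theorem card_pairTransversal {V ι : Type*} [Fintype ι] (e : ι × Bool ≃ V) (s : ι → Bool) :
    (pairTransversal e s).card = Fintype.card ι := by
  simp [pairTransversal]

theorem card_inter_pairTransversal {V ι : Type*} [Fintype ι] [DecidableEq V]
    (e : ι × Bool ≃ V) (s : ι → Bool) (N : Finset V) :
    ((N ∩ pairTransversal e s).card : ℝ) = ∑ i, if e (i, s i) ∈ N then 1 else 0 := by
  rw [Finset.inter_comm, ← Finset.filter_mem_eq_inter, Finset.card_filter, pairTransversal,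
    Finset.sum_map]
  push_cast
  rfl

/-- There is `n₀` such that for all `n ≥ n₀`: given a simple graph `G` on `2n` vertices
and `2t` distinct vertices `x₁,y₁,…,x_t,y_t` with `1 ≤ t ≤ n`, the vertex set can be
partitioned into parts `A` and `B` of equal size with `|A ∩ {x_i,y_i}| = 1` for each `i`
and `|d_A(v) − d_B(v)| ≤ n^{2/3} − 1` for every vertex `v`. -/
theorem balanced_partition :
    ∃ n₀ : ℕ, 0 < n₀ ∧
      ∀ n : ℕ, n₀ ≤ n →
        ∀ (V : Type) [Fintype V] [DecidableEq V] (G : SimpleGraph V) [DecidableRel G.Adj],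
          Fintype.card V = 2 * n →
          ∀ t : ℕ, 1 ≤ t → t ≤ n →
            ∀ a b : Fin t → V,
              (∀ i j, i ≠ j → a i ≠ a j) →
              (∀ i j, i ≠ j → b i ≠ b j) →
              (∀ i j, a i ≠ b j) →
              ∃ A B : Finset V,
                Disjoint A B ∧ A ∪ B = Finset.univ ∧
                A.card = B.card ∧
                (∀ i, (A ∩ {a i, b i}).card = 1) ∧
                (∀ v : V,
                  |((G.neighborFinset v ∩ A).card : ℝ) - ((G.neighborFinset v ∩ B).card : ℝ)|
                    ≤ (n : ℝ) ^ ((2 : ℝ) / 3) - 1) := by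
  obtain ⟨n₀, h₀⟩ := Filter.eventually_atTop.1 eventually_sqrt_mul_log_add_le
  refine ⟨n₀ + 1, by omega, ?_⟩
  intro n hn V _ _ G _ hV t ht htn a b ha hb hab
  obtain ⟨e, he⟩ := exists_equiv_prod_bool_extending hV ht htn a b ha hb hab
  have hn' : 0 < n := by omega
  have hn0 : (0 : ℝ) < n := by exact_mod_cast hn'
  let ind : V → Fin n × Bool → ℝ := fun v p ↦ if e p ∈ G.neighborFinset v then 1 else 0
  obtain ⟨s, hs⟩ := exists_signs_exp_mul_abs_sum_le
    (fun v i ↦ ind v (i, true) - ind v (i, false))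
    (fun v i ↦ by simp only [ind]; split_ifs <;> norm_num) (√n)⁻¹
  refine ⟨pairTransversal e s, pairTransversal e fun i ↦ !s i, ?_, ?_, ?_, ?_, ?_⟩
  · rw [Finset.disjoint_left]
    intro v
    obtain ⟨⟨i, x⟩, rfl⟩ := e.surjective v
    simp only [apply_mem_pairTransversal]
    grind
  · ext v
    obtain ⟨⟨i, x⟩, rfl⟩ := e.surjective v
    simp only [Finset.mem_union, apply_mem_pairTransversal, Finset.mem_univ, iff_true]
    cases s i <;> cases x <;> decide
  · rw [card_pairTransversal, card_pairTransversal]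
  · intro i
    rw [Finset.card_eq_one]
    refine ⟨e (Fin.castLE htn i, s (Fin.castLE htn i)), ?_⟩
    rw [← (he i).1, ← (he i).2]
    ext v
    obtain ⟨⟨j, x⟩, rfl⟩ := e.surjective v
    simp only [Finset.mem_inter, apply_mem_pairTransversal, Finset.mem_insert,
      Finset.mem_singleton, e.apply_eq_iff_eq, Prod.mk.injEq]
    grind
  · intro v
    refine le_trans ?_ (h₀ n (by omega))
    have hdiff : ((G.neighborFinset v ∩ pairTransversal e s).card : ℝ) -
        ((G.neighborFinset v ∩ pairTransversal e fun i ↦ !s i).card : ℝ) =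
        ∑ i, (ind v (i, true) - ind v (i, false)) * (if s i then 1 else -1) := by
      rw [card_inter_pairTransversal, card_inter_pairTransversal, ← Finset.sum_sub_distrib]
      refine Finset.sum_congr rfl fun i _ ↦ ?_
      cases h : s i <;> simp [ind]
    rw [hdiff]
    have hv := Real.log_le_log (Real.exp_pos _) (hs v)
    have hsq : 0 < √(n : ℝ) := Real.sqrt_pos.2 hn0
    rw [Real.log_exp, hV, Fintype.card_fin, Real.log_mul (by positivity) (by positivity),
      Real.log_exp, inv_pow, Real.sq_sqrt hn0.le, inv_mul_le_iff₀ hsq] at hv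
    convert hv using 3
    · push_cast
      ring_nf
    · rw [mul_div_assoc', mul_inv_cancel₀ hn0.ne']
end
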